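/- Let f : ℂ → ℂ be smooth, n ≤ 0 an integer, and suppose f(e^{iφ} z) = e^{inφ} f(z) for all φ ∈ ℝ and z ∈ ℂ. Then there exists a smooth function h of the variable a = r² such that f(r e^{iφ}) = e^{inφ} r^{-n} h(r²) for all r ≥ 0, φ ∈ ℝ; equivalently f(z) = z̄^{|n|} h(|z|²). -/

import Mathlib

open scoped ContDiff Topology
open Filter

/-- Borel's lemma: every sequence is the sequence of derivatives at `0` of a smooth function. -/
theorem exists_contDiff_iteratedDeriv_zero_eq (c : ℕ → ℂ) :
    ∃ b : ℝ → ℂ, ContDiff ℝ ∞ b ∧ ∀ k, iteratedDeriv k b 0 = c k := by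
  let χ : ContDiffBump (0 : ℝ) := default
  let η : ℕ → ℝ → ℂ := fun k y => (χ y * y ^ k) • (c k / k.factorial)
  have hη : ∀ k, ContDiff ℝ ∞ (η k) := fun k =>
    ((χ.contDiff.mul (contDiff_id.pow k)).smul contDiff_const)
  have hηc : ∀ k, HasCompactSupport (η k) := fun k =>
    (χ.hasCompactSupport.mul_right).smul_right
  have hbd : ∀ k j, ∃ C : ℝ, 0 ≤ C ∧ ∀ y, ‖iteratedDeriv j (η k) y‖ ≤ C := by
    intro k j
    obtain ⟨C, hC⟩ := ((hηc k).iteratedFDeriv (𝕜 := ℝ) j).exists_bound_of_continuous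
      ((hη k).continuous_iteratedFDeriv (by exact_mod_cast le_top))
    refine ⟨C, (norm_nonneg _).trans (hC 0), fun y => ?_⟩
    rw [← norm_iteratedFDeriv_eq_norm_iteratedDeriv]
    exact hC y
  choose C hC0 hC using hbd
  let S : ℕ → ℝ := fun k => ∑ j ∈ Finset.range k, C k j
  have hS0 : ∀ k, 0 ≤ S k := fun k => Finset.sum_nonneg fun j _ => hC0 k j
  let ε : ℕ → ℝ := fun k => (1 / 2) ^ k / (S k + 1)
  have hε0 : ∀ k, 0 < ε k := fun k => div_pos (by positivity) (by linarith [hS0 k])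
  have hε1 : ∀ k, ε k ≤ 1 := fun k => by
    rw [div_le_one (by linarith [hS0 k])]
    exact (pow_le_one₀ (by norm_num) (by norm_num)).trans (by linarith [hS0 k])
  let F : ℕ → ℝ → ℂ := fun k x => (ε k ^ k) • η k ((ε k)⁻¹ * x)
  have hF : ∀ k, ContDiff ℝ ∞ (F k) := fun k =>
    ((hη k).comp (contDiff_const.mul contDiff_id : ContDiff ℝ ∞ fun x => (ε k)⁻¹ * x)).const_smul _
  have hFder : ∀ k j x, iteratedDeriv j (F k) x
      = (ε k ^ k * (ε k)⁻¹ ^ j) • iteratedDeriv j (η k) ((ε k)⁻¹ * x) := by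
    intro k j x
    have h1 := iteratedDeriv_fun_const_smul_field (n := j) (x := x) (ε k ^ k)
      (fun x => η k ((ε k)⁻¹ * x))
    rw [show F k = fun x => (ε k ^ k) • η k ((ε k)⁻¹ * x) from rfl, h1,
      iteratedDeriv_comp_const_smul ((hη k).of_le (by exact_mod_cast le_top)), smul_smul]
  let v : ℕ → ℕ → ℝ := fun j k => if j < k then (1 / 2) ^ k else ε k ^ k * (ε k)⁻¹ ^ j * C k j
  have hv : ∀ j : ℕ, Summable (v j) := by
    intro j
    refine (summable_congr_atTop ?_).2 (summable_geometric_of_lt_one (r := 1 / 2) (by norm_num)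
      (by norm_num))
    filter_upwards [eventually_gt_atTop j] with k hk
    exact if_pos hk
  have hFv : ∀ (j k : ℕ) (x : ℝ), ‖iteratedFDeriv ℝ j (F k) x‖ ≤ v j k := by
    intro j k x
    have h0 := hε0 k
    rw [norm_iteratedFDeriv_eq_norm_iteratedDeriv, hFder, norm_smul, Real.norm_of_nonneg
      (by positivity)]
    have h1 := hC k j ((ε k)⁻¹ * x)
    by_cases hjk : j < k
    · have h2 : ε k ^ k * (ε k)⁻¹ ^ j ≤ ε k := by
        rw [inv_pow, ← pow_sub₀ _ h0.ne' hjk.le]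
        exact pow_le_of_le_one h0.le (hε1 k) (by lia)
      have h3 : C k j ≤ S k :=
        Finset.single_le_sum (fun i _ => hC0 k i) (Finset.mem_range.2 hjk)
      calc _ ≤ ε k * (S k + 1) := by
            gcongr
            linarith
        _ = (1 / 2) ^ k := div_mul_cancel₀ _ (by linarith [hS0 k])
        _ = v j k := (if_pos hjk).symm
    · calc _ ≤ ε k ^ k * (ε k)⁻¹ ^ j * C k j := by gcongr
        _ = v j k := (if_neg hjk).symm
  have hF0 : ∀ k j, iteratedDeriv j (F k) 0 = if j = k then c k else 0 := by
    intro k j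
    have hev : F k =ᶠ[𝓝 0] fun x : ℝ => (x ^ k) • (c k / k.factorial) := by
      have ht : Tendsto (fun x : ℝ => (ε k)⁻¹ * x) (𝓝 0) (𝓝 0) := by
        simpa using (continuous_const_mul (ε k)⁻¹).tendsto (0 : ℝ)
      filter_upwards [ht.eventually χ.eventuallyEq_one] with x hx
      have h0 := (hε0 k).ne'
      simp only [F, η, hx, Pi.one_apply, smul_smul]
      rw [one_mul, ← mul_pow, mul_inv_cancel_left₀ h0]
    rw [hev.iteratedDeriv_eq, iteratedDeriv_smul_const (contDiffAt_id.pow k),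
      iteratedDeriv_fun_pow_zero]
    split_ifs
    · have : (k.factorial : ℂ) ≠ 0 := by exact_mod_cast k.factorial_ne_zero
      rw [Complex.real_smul]
      push_cast
      field_simp
    · simp
  refine ⟨fun x => ∑' k, F k x, contDiff_tsum (N := ⊤) hF (fun j _ => hv j) (fun j k x _ => hFv j k x), ?_⟩
  intro k
  have hsum := iteratedFDeriv_tsum_apply (N := ⊤) hF (fun j _ => hv j) (fun j k x _ => hFv j k x)
    (k := k) le_top 0
  have hz : ∀ i, i ≠ k → iteratedFDeriv ℝ k (F i) 0 = 0 := fun i hi => by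
    rw [← norm_eq_zero, norm_iteratedFDeriv_eq_norm_iteratedDeriv, hF0, if_neg hi.symm, norm_zero]
  rw [iteratedDeriv, hsum, tsum_eq_single k hz, ← iteratedDeriv, hF0, if_pos rfl]

/-- A smooth function of a real variable all of whose derivatives vanish at `0`. -/
structure IsFlatAtZero (u : ℝ → ℂ) : Prop where
  contDiff : ContDiff ℝ ∞ u
  iteratedDeriv_eq_zero : ∀ k, iteratedDeriv k u 0 = 0

namespace IsFlatAtZero

variable {u : ℝ → ℂ}

protected theorem deriv (hu : IsFlatAtZero u) : IsFlatAtZero (deriv u) where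
  contDiff := (contDiff_infty_iff_deriv.1 hu.contDiff).2
  iteratedDeriv_eq_zero k := by
    rw [← iteratedDeriv_succ']
    exact hu.iteratedDeriv_eq_zero (k + 1)

theorem exists_norm_le (hu : IsFlatAtZero u) (N : ℕ) :
    ∃ C, 0 ≤ C ∧ ∀ x ∈ Set.Icc (0 : ℝ) 1, ‖u x‖ ≤ C * x ^ N := by
  induction N generalizing u with
  | zero =>
    obtain ⟨C, hC⟩ := isCompact_Icc.exists_bound_of_continuousOn
      (s := Set.Icc (0 : ℝ) 1) hu.contDiff.continuous.continuousOn
    exact ⟨C, (norm_nonneg _).trans (hC 0 (by simp)), fun x hx => by simpa using hC x hx⟩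
  | succ N ih =>
    obtain ⟨C, hC0, hC⟩ := ih hu.deriv
    refine ⟨C, hC0, fun x hx => ?_⟩
    have hdiff := (contDiff_infty_iff_deriv.1 hu.contDiff).1
    have h0 : u 0 = 0 := by simpa using hu.iteratedDeriv_eq_zero 0
    have h := norm_image_sub_le_of_norm_deriv_le_segment' (f := u) (a := 0) (b := x)
      (C := C * x ^ N) (fun y _ => (hdiff y).hasDerivAt.hasDerivWithinAt)
      (fun y hy => (hC y ⟨hy.1, hy.2.le.trans hx.2⟩).trans
        (mul_le_mul_of_nonneg_left (pow_le_pow_left₀ hy.1 hy.2.le N) hC0))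
      x ⟨hx.1, le_rfl⟩
    rw [h0, sub_zero, sub_zero] at h
    exact h.trans_eq (by ring)

end IsFlatAtZero

/-- The function `a ↦ a^{-j/2} u(√a)` on the positive half-line, extended by zero. -/
noncomputable def sqrtQuotient (j : ℕ) (u : ℝ → ℂ) (a : ℝ) : ℂ :=
  if 0 < a then (√a)⁻¹ ^ j • u √a else 0

namespace IsFlatAtZero

variable {u : ℝ → ℂ}

theorem hasDerivAt_sqrtQuotient (hu : IsFlatAtZero u) (j : ℕ) (a : ℝ) :
    HasDerivAt (sqrtQuotient j u)
      ((-(j / 2) : ℝ) • sqrtQuotient (j + 2) u a +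
        (1 / 2 : ℝ) • sqrtQuotient (j + 1) (deriv u) a) a := by
  rcases lt_trichotomy a 0 with ha | rfl | ha
  · have hev : sqrtQuotient j u =ᶠ[𝓝 a] fun _ => 0 := by
      filter_upwards [gt_mem_nhds ha] with x hx
      exact if_neg hx.not_gt
    simpa [sqrtQuotient, ha.not_gt] using (hasDerivAt_const a (0 : ℂ)).congr_of_eventuallyEq hev
  · obtain ⟨C, hC0, hC⟩ := hu.exists_norm_le (j + 4)
    have hbd : ∀ x : ℝ, |x| ≤ 1 → ‖sqrtQuotient j u x‖ ≤ C * ‖x‖ ^ 2 := by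
      intro x hx
      rw [sqrtQuotient]
      split_ifs with h
      · have hs : 0 < √x := Real.sqrt_pos.2 h
        have h1 := hC √x ⟨hs.le, Real.sqrt_le_one.2 (le_of_abs_le hx)⟩
        rw [norm_smul, Real.norm_of_nonneg (by positivity), Real.norm_of_nonneg h.le]
        calc (√x)⁻¹ ^ j * ‖u √x‖ ≤ (√x)⁻¹ ^ j * (C * √x ^ (j + 4)) := by gcongr
          _ = C * (√x ^ 2) ^ 2 := by
            rw [pow_add, inv_pow]
            field_simp
          _ = C * x ^ 2 := by rw [Real.sq_sqrt h.le]
      · simpa using by positivity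
    have hO : sqrtQuotient j u =O[𝓝 0] fun x : ℝ => x ^ 2 := by
      refine Asymptotics.IsBigO.of_bound C ?_
      filter_upwards [Metric.closedBall_mem_nhds (0 : ℝ) one_pos] with x hx
      rw [norm_pow]
      exact hbd x (by simpa using hx)
    have h0 : ∀ i (w : ℝ → ℂ), sqrtQuotient i w 0 = 0 := fun i w => if_neg (lt_irrefl _)
    rw [h0, h0, smul_zero, smul_zero, add_zero, hasDerivAt_iff_isLittleO, h0]
    simpa using hO.trans_isLittleO (Asymptotics.isLittleO_pow_id (one_lt_two))
  · have hev : sqrtQuotient j u =ᶠ[𝓝 a] fun x => (√x)⁻¹ ^ j • u √x := by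
      filter_upwards [lt_mem_nhds ha] with x hx
      exact if_pos hx
    have hs : 0 < √a := Real.sqrt_pos.2 ha
    have hd := ((contDiff_infty_iff_deriv.1 hu.contDiff).1 √a).hasDerivAt
    have h1 := Real.hasDerivAt_sqrt ha.ne'
    have h2 := ((h1.inv hs.ne').pow j).smul (hd.scomp a h1)
    refine (h2.congr_of_eventuallyEq hev).congr_deriv ?_
    simp only [sqrtQuotient, if_pos ha, smul_smul]
    rw [add_comm]
    congr 2
    · rcases j with _ | j
      · simp
      · simp
        field_simp
        ring
    · simp only [Pi.pow_apply, Pi.inv_apply, inv_pow]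
      field_simp
      ring

theorem contDiff_sqrtQuotient (hu : IsFlatAtZero u) (j : ℕ) :
    ContDiff ℝ ∞ (sqrtQuotient j u) := by
  refine contDiff_infty.2 fun n => ?_
  induction n generalizing u j with
  | zero =>
    refine contDiff_zero.2 (continuous_iff_continuousAt.2 fun a => ?_)
    exact (hu.hasDerivAt_sqrtQuotient j a).continuousAt
  | succ n ih =>
    push_cast
    refine contDiff_succ_iff_deriv.2 ⟨fun a => (hu.hasDerivAt_sqrtQuotient j a).differentiableAt,
      by simp, ?_⟩
    rw [funext fun a => (hu.hasDerivAt_sqrtQuotient j a).deriv]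
    exact ((ih hu (j + 2)).const_smul _).add ((ih hu.deriv (j + 1)).const_smul _)

end IsFlatAtZero

/-- `f` transforms with weight `n` under rotations of the plane. -/
def HasRotationWeight (n : ℤ) (f : ℂ → ℂ) : Prop :=
  ∀ (φ : ℝ) (z : ℂ),
    f (Complex.exp (φ * Complex.I) * z) = Complex.exp ((n : ℂ) * φ * Complex.I) * f z

/-- The Wirtinger derivative `∂f/∂z`. -/
noncomputable def wirtingerDeriv (f : ℂ → ℂ) (z : ℂ) : ℂ :=
  (fderiv ℝ f z 1 - Complex.I * fderiv ℝ f z Complex.I) / 2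

/-- The Wirtinger derivative `∂f/∂z̄`. -/
noncomputable def wirtingerDerivConj (f : ℂ → ℂ) (z : ℂ) : ℂ :=
  (fderiv ℝ f z 1 + Complex.I * fderiv ℝ f z Complex.I) / 2

theorem fderiv_apply_eq_wirtinger (f : ℂ → ℂ) (z v : ℂ) :
    fderiv ℝ f z v
      = wirtingerDeriv f z * v + wirtingerDerivConj f z * (starRingEnd ℂ v) := by
  have h : fderiv ℝ f z v
      = (v.re : ℂ) * fderiv ℝ f z 1 + (v.im : ℂ) * fderiv ℝ f z Complex.I := by
    conv_lhs => rw [show v = v.re • (1 : ℂ) + v.im • Complex.I by simp [Complex.re_add_im]]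
    rw [map_add, map_smul, map_smul, Complex.real_smul, Complex.real_smul]
  have hc : starRingEnd ℂ v = v.re - v.im * Complex.I := by
    apply Complex.ext <;> simp
  have hv : v = v.re + v.im * Complex.I := (Complex.re_add_im v).symm
  rw [h, hc, wirtingerDeriv, wirtingerDerivConj]
  linear_combination (-(fderiv ℝ f z 1 - Complex.I * fderiv ℝ f z Complex.I) / 2) * hv
    + v.im * fderiv ℝ f z Complex.I * Complex.I_sq

theorem ContDiff.wirtingerDeriv {f : ℂ → ℂ} (hf : ContDiff ℝ ∞ f) :
    ContDiff ℝ ∞ (wirtingerDeriv f) := by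
  have h := hf.fderiv_right (m := ∞) (by simp)
  exact ((h.clm_apply contDiff_const).sub
    (contDiff_const.mul (h.clm_apply contDiff_const))).div_const _

theorem ContDiff.wirtingerDerivConj {f : ℂ → ℂ} (hf : ContDiff ℝ ∞ f) :
    ContDiff ℝ ∞ (wirtingerDerivConj f) := by
  have h := hf.fderiv_right (m := ∞) (by simp)
  exact ((h.clm_apply contDiff_const).add
    (contDiff_const.mul (h.clm_apply contDiff_const))).div_const _

namespace HasRotationWeight

variable {n : ℤ} {f g : ℂ → ℂ}

theorem sub (hf : HasRotationWeight n f) (hg : HasRotationWeight n g) :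
    HasRotationWeight n (fun z => f z - g z) := fun φ z => by
  simp only [hf φ z, hg φ z, mul_sub]

theorem fderiv_apply (h : HasRotationWeight n f) (hf : Differentiable ℝ f) (φ : ℝ) (z v : ℂ) :
    fderiv ℝ f (Complex.exp (φ * Complex.I) * z) (Complex.exp (φ * Complex.I) * v)
      = Complex.exp ((n : ℂ) * φ * Complex.I) * fderiv ℝ f z v := by
  set e := Complex.exp (φ * Complex.I)
  have h1 : HasFDerivAt (fun w => e * w) (e • ContinuousLinearMap.id ℝ ℂ) z :=
    (hasFDerivAt_id z).const_mul e
  have h2 := (hf (e * z)).hasFDerivAt.comp z h1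
  have h3 := (hf z).hasFDerivAt.const_mul (Complex.exp ((n : ℂ) * φ * Complex.I))
  have h4 := h2.unique (h3.congr_of_eventuallyEq (Eventually.of_forall (h φ)))
  simpa using congr($h4 v)

theorem wirtinger_aux (h : HasRotationWeight n f) (hf : Differentiable ℝ f) (φ : ℝ) (z : ℂ) :
    Complex.exp (φ * Complex.I) * wirtingerDeriv f (Complex.exp (φ * Complex.I) * z)
        = Complex.exp ((n : ℂ) * φ * Complex.I) * wirtingerDeriv f z ∧
      Complex.exp (-(φ * Complex.I)) * wirtingerDerivConj f (Complex.exp (φ * Complex.I) * z)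
        = Complex.exp ((n : ℂ) * φ * Complex.I) * wirtingerDerivConj f z := by
  have h1 := h.fderiv_apply hf φ z 1
  have h2 := h.fderiv_apply hf φ z Complex.I
  have hc : starRingEnd ℂ (Complex.exp (φ * Complex.I)) = Complex.exp (-(φ * Complex.I)) := by
    rw [← Complex.exp_conj]
    simp
  simp only [fderiv_apply_eq_wirtinger, map_mul, hc, map_one, Complex.conj_I] at h1 h2
  constructor
  · linear_combination h1 / 2 - Complex.I * h2 / 2 + (Complex.exp (φ * Complex.I) *
      wirtingerDeriv f (Complex.exp (φ * Complex.I) * z) - Complex.exp (-(φ * Complex.I)) *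
      wirtingerDerivConj f (Complex.exp (φ * Complex.I) * z)
      - Complex.exp ((n : ℂ) * φ * Complex.I) * wirtingerDeriv f z
      + Complex.exp ((n : ℂ) * φ * Complex.I) * wirtingerDerivConj f z) / 2 * Complex.I_sq
  · linear_combination h1 / 2 + Complex.I * h2 / 2 - (Complex.exp (φ * Complex.I) *
      wirtingerDeriv f (Complex.exp (φ * Complex.I) * z) - Complex.exp (-(φ * Complex.I)) *
      wirtingerDerivConj f (Complex.exp (φ * Complex.I) * z)
      - Complex.exp ((n : ℂ) * φ * Complex.I) * wirtingerDeriv f z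
      + Complex.exp ((n : ℂ) * φ * Complex.I) * wirtingerDerivConj f z) / 2 * Complex.I_sq

theorem wirtingerDeriv (h : HasRotationWeight n f) (hf : Differentiable ℝ f) :
    HasRotationWeight (n - 1) (wirtingerDeriv f) := fun φ z => by
  apply mul_left_cancel₀ (Complex.exp_ne_zero (φ * Complex.I))
  rw [(h.wirtinger_aux hf φ z).1, ← mul_assoc, ← Complex.exp_add]
  congr 2
  push_cast
  ring

theorem wirtingerDerivConj (h : HasRotationWeight n f) (hf : Differentiable ℝ f) :
    HasRotationWeight (n + 1) (wirtingerDerivConj f) := fun φ z => by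
  apply mul_left_cancel₀ (Complex.exp_ne_zero (-(φ * Complex.I)))
  rw [(h.wirtinger_aux hf φ z).2, ← mul_assoc, ← Complex.exp_add]
  congr 2
  push_cast
  ring

theorem apply_zero (h : HasRotationWeight n f) (hn : n ≠ 0) : f 0 = 0 := by
  have hn' : (n : ℂ) ≠ 0 := Int.cast_ne_zero.2 hn
  have h1 := h (Real.pi / n) 0
  have h2 : (n : ℂ) * ((Real.pi / n : ℝ) : ℂ) * Complex.I = Real.pi * Complex.I := by
    push_cast
    field_simp
  rw [mul_zero, h2, Complex.exp_pi_mul_I] at h1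
  linear_combination h1 / 2

/-- On the real axis, the only derivatives at `0` that can survive are those whose order is
`p + q` with `p - q` equal to the weight. -/
theorem iteratedDeriv_ofReal_eq_zero (h : HasRotationWeight n f) (hf : ContDiff ℝ ∞ f) {k : ℕ}
    (hk : ∀ p q : ℕ, p + q = k → (p : ℤ) - q ≠ n) :
    iteratedDeriv k (fun x : ℝ => f x) 0 = 0 := by
  induction k generalizing n f with
  | zero =>
    simpa using h.apply_zero (by simpa using (hk 0 0 rfl).symm)
  | succ k ih =>
    have hd : Differentiable ℝ f := hf.differentiable (by simp)
    have hderiv : deriv (fun x : ℝ => f x) =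
        (fun x : ℝ => _root_.wirtingerDeriv f x) + fun x : ℝ => _root_.wirtingerDerivConj f x := by
      funext x
      have h1 := (hd x).hasFDerivAt.comp_hasDerivAt x (Complex.ofRealCLM.hasDerivAt (x := x))
      refine (h1.deriv).trans ?_
      simp [fderiv_apply_eq_wirtinger]
    have hA := hf.wirtingerDeriv
    have hB := hf.wirtingerDerivConj
    have hof : ContDiff ℝ ∞ ((↑) : ℝ → ℂ) := Complex.ofRealCLM.contDiff
    have hA' : ContDiffAt ℝ k (fun x : ℝ => _root_.wirtingerDeriv f x) 0 :=
      ((hA.comp hof).of_le (by exact_mod_cast le_top)).contDiffAt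
    have hB' : ContDiffAt ℝ k (fun x : ℝ => _root_.wirtingerDerivConj f x) 0 :=
      ((hB.comp hof).of_le (by exact_mod_cast le_top)).contDiffAt
    rw [iteratedDeriv_succ', hderiv, iteratedDeriv_add hA' hB',
      ih (h.wirtingerDeriv hd) hA, ih (h.wirtingerDerivConj hd) hB, add_zero]
    · intro p q hpq
      have := hk p (q + 1) (by lia)
      push_cast at this
      lia
    · intro p q hpq
      have := hk (p + 1) q (by lia)
      push_cast at this
      lia

end HasRotationWeight

theorem contDiff_conj_pow_mul_normSq (m : ℕ) {b : ℝ → ℂ} (hb : ContDiff ℝ ∞ b) :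
    ContDiff ℝ ∞ fun z : ℂ => (starRingEnd ℂ z) ^ m * b (Complex.normSq z) := by
  have h1 : ContDiff ℝ ∞ fun z : ℂ => starRingEnd ℂ z := Complex.conjCLE.contDiff
  have h2 : ContDiff ℝ ∞ fun z : ℂ => Complex.normSq z := by
    simp only [Complex.normSq_eq_norm_sq]
    exact contDiff_norm_sq ℝ
  exact (h1.pow m).mul (hb.comp h2)

theorem hasRotationWeight_conj_pow_mul_normSq (m : ℕ) (b : ℝ → ℂ) :
    HasRotationWeight (-m) fun z : ℂ => (starRingEnd ℂ z) ^ m * b (Complex.normSq z) := by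
  intro φ z
  have hc : starRingEnd ℂ (Complex.exp (φ * Complex.I)) = Complex.exp (-(φ * Complex.I)) := by
    rw [← Complex.exp_conj]
    simp
  have hn : Complex.normSq (Complex.exp (φ * Complex.I)) = 1 := by
    rw [Complex.normSq_eq_norm_sq, Complex.norm_exp_ofReal_mul_I, one_pow]
  beta_reduce
  rw [map_mul, map_mul, hc, hn, one_mul, mul_pow, ← Complex.exp_nat_mul, mul_assoc]
  congr 2
  push_cast
  ring

theorem iteratedDeriv_pow_mul_comp_sq_of_lt {b : ℝ → ℂ} (hb : ContDiff ℝ ∞ b) {m k : ℕ}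
    (hk : k < m) : iteratedDeriv k (fun x : ℝ => (x : ℂ) ^ m * b (x ^ 2)) 0 = 0 := by
  have h := (hasRotationWeight_conj_pow_mul_normSq m b).iteratedDeriv_ofReal_eq_zero
    (contDiff_conj_pow_mul_normSq m hb) (k := k) (fun p q _ => by lia)
  simpa [Complex.normSq_ofReal, ← sq] using h

theorem iteratedDeriv_pow_mul_comp_sq {b : ℝ → ℂ} (hb : ContDiff ℝ ∞ b) (m l : ℕ) :
    l.factorial * iteratedDeriv (m + 2 * l) (fun x : ℝ => (x : ℂ) ^ m * b (x ^ 2)) 0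
      = (m + 2 * l).factorial * iteratedDeriv l b 0 := by
  induction hk : m + 2 * l generalizing m l b with
  | zero =>
    obtain ⟨rfl, rfl⟩ : m = 0 ∧ l = 0 := by lia
    simp
  | succ k ih =>
    have hb' := contDiff_infty_iff_deriv.1 hb
    have hpow : ∀ (i : ℕ) {w : ℝ → ℂ}, ContDiff ℝ ∞ w →
        ContDiffAt ℝ k (fun x : ℝ => (x : ℂ) ^ i * w (x ^ 2)) 0 := fun i w hw =>
      ((((Complex.ofRealCLM.contDiff (n := ∞)).pow i).mul (hw.comp (contDiff_id.pow 2))).of_le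
        (by exact_mod_cast le_top)).contDiffAt
    have hderiv : deriv (fun x : ℝ => (x : ℂ) ^ m * b (x ^ 2)) =
        (fun x : ℝ => (m : ℂ) * ((x : ℂ) ^ (m - 1) * b (x ^ 2))) +
          fun x : ℝ => (2 : ℂ) * ((x : ℂ) ^ (m + 1) * deriv b (x ^ 2)) := by
      funext x
      have h1 : HasDerivAt (fun x : ℝ => (x : ℂ)) 1 x := Complex.ofRealCLM.hasDerivAt
      have h2 : HasDerivAt (fun x : ℝ => x ^ 2) (2 * x) x := by simpa using hasDerivAt_pow 2 x
      have h3 := (h1.pow m).mul ((hb'.1 (x ^ 2)).hasDerivAt.scomp x h2)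
      refine h3.deriv.trans ?_
      simp
      ring
    rw [iteratedDeriv_succ', hderiv, iteratedDeriv_add (contDiffAt_const.mul (hpow _ hb))
      (contDiffAt_const.mul (hpow _ hb'.2)), iteratedDeriv_const_mul _ (hpow _ hb),
      iteratedDeriv_const_mul _ (hpow _ hb'.2)]
    have hA : l.factorial * ((m : ℂ) * iteratedDeriv k
        (fun x : ℝ => (x : ℂ) ^ (m - 1) * b (x ^ 2)) 0)
        = m * k.factorial * iteratedDeriv l b 0 := by
      rcases m with _ | m
      · simp
      · have := ih hb m l (by lia)
        simp only [Nat.add_sub_cancel]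
        linear_combination ((m + 1 : ℕ) : ℂ) * this
    have hB : l.factorial * iteratedDeriv k
        (fun x : ℝ => (x : ℂ) ^ (m + 1) * deriv b (x ^ 2)) 0
        = l * k.factorial * iteratedDeriv l b 0 := by
      rcases l with _ | l
      · simp [iteratedDeriv_pow_mul_comp_sq_of_lt hb'.2 (show k < m + 1 by lia)]
      · have := ih hb'.2 (m + 1) l (by lia)
        rw [← iteratedDeriv_succ'] at this
        rw [Nat.factorial_succ]
        push_cast
        linear_combination ((l : ℂ) + 1) * this
    have hk' : (m : ℂ) + 2 * l = k + 1 := by exact_mod_cast hk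
    rw [Nat.factorial_succ]
    push_cast
    linear_combination hA + 2 * hB + k.factorial * iteratedDeriv l b 0 * hk'


/-- A smooth function `f : ℂ → ℂ` with `f(e^{iφ} z) = e^{inφ} f(z)` for `n ≤ 0` has the
form `f(r e^{iφ}) = e^{inφ} r^{-n} h(r²)`, equivalently `f(z) = z̄^{|n|} h(|z|²)`,
with `h` a smooth function of `a = r²`. -/
theorem stmt9 (f : ℂ → ℂ) (hf : ContDiff ℝ (⊤ : ℕ∞) f) (n : ℤ) (hn : n ≤ 0)
    (hequiv : ∀ (φ : ℝ) (z : ℂ),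
      f (Complex.exp (φ * Complex.I) * z) = Complex.exp ((n : ℂ) * φ * Complex.I) * f z) :
    ∃ h : ℝ → ℂ, ContDiff ℝ (⊤ : ℕ∞) h ∧
      (∀ (r : ℝ), 0 ≤ r → ∀ φ : ℝ,
        f ((r : ℂ) * Complex.exp (φ * Complex.I))
          = Complex.exp ((n : ℂ) * φ * Complex.I) * (r : ℂ) ^ (-n).toNat * h (r ^ 2))
      ∧ ∀ z : ℂ, f z = (starRingEnd ℂ z) ^ n.natAbs * h (Complex.normSq z) := by
  obtain ⟨m, rfl⟩ : ∃ m : ℕ, n = -m := ⟨n.natAbs, by lia⟩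
  have hw : HasRotationWeight (-m) f := hequiv
  have hof : ContDiff ℝ ∞ ((↑) : ℝ → ℂ) := Complex.ofRealCLM.contDiff
  obtain ⟨b, hb, hbc⟩ := exists_contDiff_iteratedDeriv_zero_eq fun l =>
    l.factorial / (m + 2 * l).factorial * iteratedDeriv (m + 2 * l) (fun x : ℝ => f x) 0
  have hF := contDiff_conj_pow_mul_normSq m hb
  have hF' : ContDiff ℝ ∞ fun x : ℝ => (x : ℂ) ^ m * b (x ^ 2) :=
    (hof.pow m).mul (hb.comp (contDiff_id.pow 2))
  have hwF := hasRotationWeight_conj_pow_mul_normSq m b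
  have hf' : ContDiff ℝ ∞ fun x : ℝ => f x := hf.comp hof
  have hflat : IsFlatAtZero fun x : ℝ => f x - (x : ℂ) ^ m * b (x ^ 2) := by
    refine ⟨hf'.sub hF', fun k => ?_⟩
    by_cases hk : ∃ l, k = m + 2 * l
    · obtain ⟨l, rfl⟩ := hk
      have h1 := iteratedDeriv_pow_mul_comp_sq hb m l
      rw [hbc] at h1
      have hl : (l.factorial : ℂ) ≠ 0 := by exact_mod_cast l.factorial_ne_zero
      have hml : ((m + 2 * l).factorial : ℂ) ≠ 0 := by
        exact_mod_cast (m + 2 * l).factorial_ne_zero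
      have h2 : iteratedDeriv (m + 2 * l) (fun x : ℝ => (x : ℂ) ^ m * b (x ^ 2)) 0
          = iteratedDeriv (m + 2 * l) (fun x : ℝ => f x) 0 := by
        apply mul_left_cancel₀ hl
        rw [h1]
        field_simp
      have h3 := iteratedDeriv_sub (n := m + 2 * l) (x := 0)
        (contDiff_infty.1 hf' _).contDiffAt (contDiff_infty.1 hF' _).contDiffAt
      exact h3.trans (by rw [h2, sub_self])
    · have h1 := (hw.sub hwF).iteratedDeriv_ofReal_eq_zero (hf.sub hF) (k := k)
        (fun p q hpq hn => hk ⟨p, by lia⟩)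
      simpa [Complex.normSq_ofReal, ← sq] using h1
  set u : ℝ → ℂ := fun x => f x - (x : ℂ) ^ m * b (x ^ 2) with hu
  have hreal : ∀ r : ℝ, 0 ≤ r → f r = (r : ℂ) ^ m * (b (r ^ 2) + sqrtQuotient m u (r ^ 2)) := by
    intro r hr
    rcases hr.eq_or_lt with rfl | hr
    · have h0 : u 0 = 0 := by simpa using hflat.iteratedDeriv_eq_zero 0
      simpa [hu, sqrtQuotient, sub_eq_zero] using h0
    · have hr' : (r : ℂ) ≠ 0 := by exact_mod_cast hr.ne'
      rw [sqrtQuotient, if_pos (by positivity), Real.sqrt_sq hr.le, Complex.real_smul, hu]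
      push_cast
      rw [mul_add, ← mul_assoc, ← mul_pow, mul_inv_cancel₀ hr', one_pow]
      ring
  have hpolar : ∀ r : ℝ, 0 ≤ r → ∀ φ : ℝ, f ((r : ℂ) * Complex.exp (φ * Complex.I))
      = Complex.exp (((-m : ℤ) : ℂ) * φ * Complex.I) * (r : ℂ) ^ m *
        (b (r ^ 2) + sqrtQuotient m u (r ^ 2)) := by
    intro r hr φ
    rw [mul_comm, hequiv, hreal r hr, ← mul_assoc]
  refine ⟨fun a => b a + sqrtQuotient m u a, hb.add (hflat.contDiff_sqrtQuotient m), ?_, ?_⟩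
  · simpa using hpolar
  · intro z
    have h1 := hpolar ‖z‖ (norm_nonneg z) z.arg
    have h2 := hasRotationWeight_conj_pow_mul_normSq m (fun a => b a + sqrtQuotient m u a)
      z.arg ‖z‖
    rw [Complex.norm_mul_exp_arg_mul_I] at h1
    rw [mul_comm _ (‖z‖ : ℂ), Complex.norm_mul_exp_arg_mul_I] at h2
    rw [h1, Int.natAbs_neg, Int.natAbs_natCast]
    refine Eq.trans ?_ h2.symm
    simp [Complex.normSq_ofReal, ← sq, mul_assoc]
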